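/- If (T^n)_{n∈ℕ} is a sequence of perfect trees and F : 2^ℕ → ℕ^ℕ is continuous, then there exist perfect trees S^n ⊆ T^n (n∈ℕ) such that either F(a) ∉ ⋃_n ι([S^n]) for all a ∈ [S^0], or F(a) = ι(a) for all a ∈ [S^0]. -/

import Mathlib

open Set

/-- A tree on binary strings: a set of finite binary strings closed under initial segments. -/
def IsTree (T : Set (List Bool)) : Prop :=
  ∀ ⦃s t : List Bool⦄, s <+: t → t ∈ T → s ∈ T

/-- The restriction `T↾s = {t ∈ T : s ⊆ t ∨ t ⊆ s}`. -/
def restr (T : Set (List Bool)) (s : List Bool) : Set (List Bool) :=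
  {t ∈ T | s <+: t ∨ t <+: s}

/-- A perfect tree: a nonempty tree with no endpoints and no isolated branches, i.e.
every node extends to a branching node. -/
def IsPerfect (T : Set (List Bool)) : Prop :=
  IsTree T ∧ T.Nonempty ∧
    ∀ s ∈ T, ∃ t ∈ T, s <+: t ∧ t ++ [false] ∈ T ∧ t ++ [true] ∈ T

/-- The initial segment `a↾n` of an infinite binary sequence. -/
def seg (a : ℕ → Bool) (n : ℕ) : List Bool := (List.range n).map a

/-- The initial segment `b↾n` of an element of Baire space. -/
def segN (b : ℕ → ℕ) (n : ℕ) : List ℕ := (List.range n).map b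

/-- The branch set `[T] = {a ∈ 2^ℕ : ∀ n, a↾n ∈ T}`. -/
def branches (T : Set (List Bool)) : Set (ℕ → Bool) := {a | ∀ n, seg a n ∈ T}

/-- The inclusion `ι : 2^ℕ → ℕ^ℕ` induced by `{0,1} ⊆ ℕ`. -/
def iota (a : ℕ → Bool) : ℕ → ℕ := fun n => (a n).toNat

/-- `r` is the root of `T`: the largest string with `T↾r = T`. -/
def IsRoot (T : Set (List Bool)) (r : List Bool) : Prop :=
  r ∈ T ∧ restr T r = T ∧ ∀ s ∈ T, restr T s = T → s <+: r

/-- The root of a (perfect) tree, via choice. -/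
noncomputable def root (T : Set (List Bool)) : List Bool :=
  Classical.epsilon fun r => IsRoot T r

/-- `T⇂i = T↾(roo(T)⌢i)`. -/
noncomputable def splitOne (T : Set (List Bool)) (i : Bool) : Set (List Bool) :=
  restr T (root T ++ [i])

/-- Iterated splitting `T⇂s`, with `T⇂Λ = T` and `T⇂(s⌢i) = (T⇂s)⇂i`. -/
noncomputable def splitAt (T : Set (List Bool)) (s : List Bool) : Set (List Bool) :=
  s.foldl splitOne T

/-- A splitting system: perfect trees `T_s` with `T_{s⌢i} ⊆ T_s⇂i`. -/
def IsSplittingSystem (Tf : List Bool → Set (List Bool)) : Prop :=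
  (∀ s, IsPerfect (Tf s)) ∧ ∀ (s : List Bool) (i : Bool), Tf (s ++ [i]) ⊆ splitOne (Tf s) i

/-- `S` is clopen in `T`: `S = ⋃_{s∈A} T↾s` for some finite `A ⊆ T`. -/
def ClopenIn (S T : Set (List Bool)) : Prop :=
  ∃ A : Set (List Bool), A.Finite ∧ A ⊆ T ∧ S = ⋃ s ∈ A, restr T s

/-- Functional perfect trees: codes for continuous functions `2^ℕ → ℕ^ℕ`. -/
def IsFPT (c : Set (List Bool × List ℕ)) : Prop :=
  (∀ p ∈ c, p.1.length = p.2.length) ∧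
  (∀ p ∈ c, ∀ n ≤ p.1.length, (p.1.take n, p.2.take n) ∈ c) ∧
  (∀ s : List Bool, ∃ u : List ℕ, (s, u) ∈ c) ∧
  (∀ p ∈ c, ∀ i : Bool, ∃ k : ℕ, (p.1 ++ [i], p.2 ++ [k]) ∈ c) ∧
  (∀ m : ℕ, ∃ k, m ≤ k ∧ ∀ s : List Bool, s.length = k →
      ∃ us : List ℕ, us.length = m ∧ ∀ u : List ℕ, (s, u) ∈ c → us <+: u)

/-- The code `cod(F) = {(a↾n, F(a)↾n) : a ∈ 2^ℕ, n ∈ ℕ}` of a function `F`. -/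
def cod (F : (ℕ → Bool) → ℕ → ℕ) : Set (List Bool × List ℕ) :=
  {p | ∃ (a : ℕ → Bool) (n : ℕ), p = (seg a n, segN (F a) n)}

/-- The relation `f_c` coded by `c`. -/
def fc (c : Set (List Bool × List ℕ)) : Set ((ℕ → Bool) × (ℕ → ℕ)) :=
  {q | ∀ m, (seg q.1 m, segN q.2 m) ∈ c}

theorem seg_length (a : ℕ → Bool) (n : ℕ) : (seg a n).length = n := by simp [seg]

theorem seg_eq_iff (a b : ℕ → Bool) (n : ℕ) : seg a n = seg b n ↔ ∀ i < n, a i = b i := by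
  simp [seg]

theorem seg_succ (a : ℕ → Bool) (n : ℕ) : seg a (n+1) = seg a n ++ [a n] := by
  simp [seg, List.range_succ]

theorem seg_take (a : ℕ → Bool) (m n : ℕ) (h : m ≤ n) : (seg a n).take m = seg a m := by
  simp [seg, List.take_range, h, ← List.map_take]

theorem seg_prefix (a : ℕ → Bool) (m n : ℕ) (h : m ≤ n) : seg a m <+: seg a n := by
  rw [← seg_take a m n h]; exact List.take_prefix _ _

theorem prefix_seg {s : List Bool} {a : ℕ → Bool} {n : ℕ} (h : s <+: seg a n) :
    s = seg a s.length := by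
  have h1 := List.prefix_iff_eq_take.1 h
  have h2 := h.length_le
  rw [seg_length] at h2
  rw [seg_take a _ _ h2] at h1
  exact h1

theorem open_cyl {U : Set (ℕ → Bool)} (hU : IsOpen U) {x : ℕ → Bool} (hx : x ∈ U) :
    ∃ k, ∀ b, seg b k = seg x k → b ∈ U := by
  obtain ⟨I, u, h1, h2⟩ := isOpen_pi_iff.1 hU x hx
  refine ⟨I.sup id + 1, fun b hb => h2 ?_⟩
  intro i hi
  have : i ≤ I.sup id := Finset.le_sup (f := id) hi
  rw [(seg_eq_iff _ _ _).1 hb i (by omega)]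
  exact (h1 i hi).2

theorem isOpen_cyl (x : ℕ → Bool) (k : ℕ) : IsOpen {b | seg b k = seg x k} := by
  have : {b | seg b k = seg x k} = ⋂ i ∈ Finset.range k, {b : ℕ → Bool | b i = x i} := by
    ext b; simp [seg_eq_iff]
  rw [this]
  refine isOpen_biInter_finset fun i _ => ?_
  exact (isOpen_discrete ({x i} : Set Bool)).preimage
    (continuous_apply (A := fun _ : ℕ => Bool) i)

theorem complMetrCantor : TopologicalSpace.IsCompletelyMetrizableSpace (ℕ → Bool) :=
  haveI : ∀ _ : ℕ, TopologicalSpace.IsCompletelyMetrizableSpace Bool := fun _ =>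
    TopologicalSpace.IsCompletelyMetrizableSpace.discrete
  TopologicalSpace.IsCompletelyMetrizableSpace.pi_countable

theorem polishCantor : PolishSpace (ℕ → Bool) :=
  have := complMetrCantor
  { }

theorem isClosed_branches (T : Set (List Bool)) : IsClosed (branches T) := by
  rw [← isOpen_compl_iff, isOpen_iff_forall_mem_open]
  intro x hx
  obtain ⟨n, hn⟩ : ∃ n, seg x n ∉ T := by simpa [branches] using hx
  refine ⟨_, ?_, isOpen_cyl x n, rfl⟩
  intro b hb hb'
  apply hn
  rw [← show seg b n = seg x n from hb]
  exact hb' n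

theorem restr_perfect {T : Set (List Bool)} (hT : IsPerfect T) {s : List Bool} (hs : s ∈ T) :
    IsPerfect (restr T s) := by
  obtain ⟨h1, h2, h3⟩ := hT
  refine ⟨?_, ⟨s, hs, Or.inl (List.prefix_refl s)⟩, ?_⟩
  · rintro u t hut ⟨ht, h⟩
    refine ⟨h1 hut ht, ?_⟩
    rcases h with h | h
    · exact List.prefix_or_prefix_of_prefix h hut
    · exact Or.inr (hut.trans h)
  · rintro t ⟨ht, h⟩
    have key : ∃ v ∈ T, t <+: v ∧ s <+: v := by
      rcases h with h | h
      · exact ⟨t, ht, List.prefix_refl t, h⟩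
      · exact ⟨s, hs, h, List.prefix_refl s⟩
    obtain ⟨v, hv, htv, hsv⟩ := key
    obtain ⟨w, hw, hvw, hw0, hw1⟩ := h3 v hv
    have hsw := hsv.trans hvw
    exact ⟨w, ⟨hw, Or.inl hsw⟩, htv.trans hvw,
      ⟨hw0, Or.inl (hsw.trans (List.prefix_append _ _))⟩,
      ⟨hw1, Or.inl (hsw.trans (List.prefix_append _ _))⟩⟩

theorem restr_subset (T : Set (List Bool)) (s : List Bool) : restr T s ⊆ T := fun _ h => h.1

theorem branches_mono {S T : Set (List Bool)} (h : S ⊆ T) : branches S ⊆ branches T :=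
  fun _ ha n => h (ha n)

theorem branches_restr {T : Set (List Bool)} {s : List Bool} {b : ℕ → Bool}
    (hb : b ∈ branches (restr T s)) : seg b s.length = s := by
  rcases (hb s.length).2 with h | h
  · exact (h.eq_of_length (by rw [seg_length])).symm
  · exact h.eq_of_length (by rw [seg_length])

theorem exists_branch {T : Set (List Bool)} (hT : IsPerfect T) {s : List Bool} (hs : s ∈ T) :
    ∃ a ∈ branches T, seg a s.length = s := by
  obtain ⟨h1, h2, h3⟩ := hT
  have step : ∀ t : T, ∃ i : Bool, (t : List Bool) ++ [i] ∈ T := by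
    rintro ⟨t, ht⟩
    obtain ⟨w, hw, htw, hw0, hw1⟩ := h3 t ht
    obtain ⟨r, rfl⟩ := htw
    cases r with
    | nil => exact ⟨false, by simpa using hw0⟩
    | cons i r => exact ⟨i, h1 ⟨r, by simp⟩ hw⟩
  choose g hg using step
  let f : ℕ → T := fun n => Nat.rec ⟨s, hs⟩ (fun _ t => ⟨t.1 ++ [g t], hg t⟩) n
  have fs : ∀ n, (f (n+1)).1 = (f n).1 ++ [g (f n)] := fun n => rfl
  have fl : ∀ n, (f n).1.length = s.length + n := by
    intro n
    induction n with
    | zero => rfl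
    | succ n ih => rw [fs, List.length_append, ih]; simp; omega
  let a : ℕ → Bool := fun n => if n < s.length then s.getD n false else g (f (n - s.length))
  have ha0 : seg a s.length = s := by
    apply List.ext_getElem
    · simp [seg]
    · intro i h _
      rw [seg_length] at h
      simp [seg, a, h]
  have han : ∀ n, seg a (s.length + n) = (f n).1 := by
    intro n
    induction n with
    | zero => exact ha0
    | succ n ih => rw [← add_assoc, seg_succ, ih, fs]; simp [a]
  refine ⟨a, fun n => ?_, ha0⟩
  exact h1 (seg_prefix a n (s.length + n) (by omega)) (by rw [han]; exact (f n).2)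

theorem branches_nonempty {T : Set (List Bool)} (hT : IsPerfect T) : (branches T).Nonempty := by
  obtain ⟨s, hs⟩ := hT.2.1
  obtain ⟨a, ha, _⟩ := exists_branch hT hs
  exact ⟨a, ha⟩

theorem aleph0_lt_cantor : Cardinal.aleph0 < Cardinal.mk (ℕ → Bool) := by
  have := Cardinal.cantor Cardinal.aleph0
  simpa using this

theorem branches_uncountable {T : Set (List Bool)} (hT : IsPerfect T) :
    ¬ (branches T).Countable := by
  have hP : Perfect (branches T) := by
    refine ⟨isClosed_branches T, ?_⟩
    rw [preperfect_iff_nhds]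
    intro x hx U hU
    obtain ⟨V, hVU, hV, hxV⟩ := mem_nhds_iff.1 hU
    obtain ⟨k, hk⟩ := open_cyl hV hxV
    obtain ⟨t, ht, hkt, h0, h1⟩ := hT.2.2 _ (hx k)
    have : ∃ i : Bool, i ≠ x t.length := ⟨!(x t.length), by simp⟩
    obtain ⟨i, hi⟩ := this
    have hti : t ++ [i] ∈ T := by cases i <;> assumption
    obtain ⟨y, hy, hys⟩ := exists_branch hT hti
    have hyl : (t ++ [i]).length = t.length + 1 := by simp
    rw [hyl, seg_succ] at hys
    obtain ⟨e1, e2⟩ := List.append_inj' hys rfl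
    have e3 : y t.length = i := by simpa using e2
    refine ⟨y, ⟨hVU (hk y ?_), hy⟩, ?_⟩
    · rw [← e1] at hkt
      have := prefix_seg hkt
      rw [seg_length] at this
      exact this.symm
    · rintro rfl
      exact hi e3.symm
  have := complMetrCantor
  let := TopologicalSpace.upgradeIsCompletelyMetrizable (ℕ → Bool)
  obtain ⟨f, hf, _, hinj⟩ := hP.exists_nat_bool_injection (branches_nonempty hT)
  intro hc
  have h1 : (Set.range f).Countable := hc.mono hf
  have h2 : (Set.univ : Set (ℕ → Bool)).Countable := by
    have := h1.preimage_of_injOn (f := f) hinj.injOn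
    simpa using this
  have h3 : Countable (ℕ → Bool) := Set.countable_univ_iff.1 h2
  exact absurd (Cardinal.mk_le_aleph0_iff.2 h3) (not_le.2 aleph0_lt_cantor)

theorem perfect_subtree {T : Set (List Bool)} {C : Set (ℕ → Bool)} (hC : MeasurableSet C)
    (hn : ¬ C.Countable) (hCT : C ⊆ branches T) :
    ∃ S, IsPerfect S ∧ S ⊆ T ∧ branches S ⊆ C := by
  have : ∃ f : (ℕ → Bool) → (ℕ → Bool),
      Set.range f ⊆ C ∧ Continuous f ∧ Function.Injective f := by
    have := polishCantor
    obtain ⟨t', ht', hp, hcl, _⟩ := hC.isClopenable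
    obtain ⟨f, h1, h2, h3⟩ :=
      @IsClosed.exists_nat_bool_injection_of_not_countable _ t' hp C hcl hn
    exact ⟨f, h1, continuous_le_rng ht' h2, h3⟩
  obtain ⟨f, hr, hc, hinj⟩ := this
  have hK : IsClosed (Set.range f) := (isCompact_range hc).isClosed
  refine ⟨{s | ∃ x n, s = seg (f x) n}, ⟨?_, ⟨_, fun _ => false, 0, rfl⟩, ?_⟩, ?_, ?_⟩
  · rintro s t hst ⟨x, n, rfl⟩
    exact ⟨x, _, prefix_seg hst⟩
  · rintro s ⟨x, n, rfl⟩
    obtain ⟨k, hk⟩ := open_cyl ((isOpen_cyl (f x) n).preimage hc) (x := x) rfl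
    let y : ℕ → Bool := fun i => if i = k then !(x k) else x i
    have hy : seg (f y) n = seg (f x) n := by
      apply hk y
      rw [seg_eq_iff]
      intro i hi
      simp [y, hi.ne]
    have hne : f y ≠ f x := by
      intro h
      have := congrFun (hinj h) k
      simp [y] at this
    have hex : ∃ m, f y m ≠ f x m := Function.ne_iff.1 hne
    classical
    let m := Nat.find hex
    have hm : f y m ≠ f x m := Nat.find_spec hex
    have hlt : ∀ i < m, f y i = f x i := fun i hi => by
      by_contra h; exact Nat.find_min hex hi h
    have hnm : n ≤ m := by
      by_contra h
      exact hm ((seg_eq_iff _ _ _).1 hy m (by omega))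
    have hseg : seg (f y) m = seg (f x) m := (seg_eq_iff _ _ _).2 hlt
    have hx1 : seg (f x) m ++ [f x m] = seg (f x) (m+1) := (seg_succ _ _).symm
    have hy1 : seg (f x) m ++ [f y m] = seg (f y) (m+1) := by rw [← hseg, seg_succ]
    refine ⟨seg (f x) m, ⟨x, m, rfl⟩, seg_prefix _ _ _ hnm, ?_, ?_⟩
    · cases h : f x m
      · exact ⟨x, m+1, by rw [← h]; exact hx1⟩
      · have h' : f y m = false := by simpa [h] using hm
        exact ⟨y, m+1, by rw [← h']; exact hy1⟩
    · cases h : f x m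
      · have h' : f y m = true := by simpa [h] using hm
        exact ⟨y, m+1, by rw [← h']; exact hy1⟩
      · exact ⟨x, m+1, by rw [← h]; exact hx1⟩
  · rintro s ⟨x, n, rfl⟩
    exact hCT (hr ⟨x, rfl⟩) n
  · intro a ha
    apply hr
    by_contra h
    obtain ⟨k, hk⟩ := open_cyl hK.isOpen_compl (x := a) h
    obtain ⟨x, n, hx⟩ := ha k
    have : n = k := by
      have := congrArg List.length hx
      simpa [seg_length] using this.symm
    subst this
    exact hk (f x) hx.symm ⟨x, rfl⟩

theorem iota_injective : Function.Injective iota := by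
  intro a b h
  funext n
  have := congrFun h n
  simp only [iota] at this
  revert this
  cases a n <;> cases b n <;> simp

theorem iota_continuous : Continuous iota :=
  continuous_pi fun n => (continuous_of_discreteTopology (f := Bool.toNat)).comp
    (continuous_apply n)

/-- Given perfect trees `T^n` and a continuous `F : 2^ℕ → ℕ^ℕ`, there are perfect
subtrees `S^n ⊆ T^n` such that either `F(a) ∉ ⋃_n ι([S^n])` for all `a ∈ [S^0]`, or
`F(a) = ι(a)` for all `a ∈ [S^0]`. -/
theorem stmt_3 (T : ℕ → Set (List Bool)) (hT : ∀ n, IsPerfect (T n))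
    (F : (ℕ → Bool) → ℕ → ℕ) (hF : Continuous F) :
    ∃ S : ℕ → Set (List Bool), (∀ n, IsPerfect (S n) ∧ S n ⊆ T n) ∧
      ((∀ a ∈ branches (S 0), F a ∉ ⋃ n, iota '' branches (S n)) ∨
       (∀ a ∈ branches (S 0), F a = iota a)) := by
  by_cases hall : ∀ a ∈ branches (T 0), F a = iota a
  · exact ⟨T, fun n => ⟨hT n, subset_rfl⟩, Or.inr hall⟩
  push Not at hall
  obtain ⟨a, ha, hne⟩ := hall
  obtain ⟨n, hn⟩ := Function.ne_iff.1 hne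
  have hopen : IsOpen {b | F b n = F a n} :=
    (isOpen_discrete {F a n}).preimage ((continuous_apply n).comp hF)
  obtain ⟨N, hN⟩ := open_cyl hopen (x := a) rfl
  obtain ⟨M, hNM, hnM⟩ : ∃ M, N ≤ M ∧ n < M := ⟨max N (n+1), by omega, by omega⟩
  obtain ⟨U, hU⟩ : ∃ U, U = restr (T 0) (seg a M) := ⟨_, rfl⟩
  have hUp : IsPerfect U := hU ▸ restr_perfect (hT 0) (ha M)
  have hUT : U ⊆ T 0 := hU ▸ restr_subset _ _
  have hUs : ∀ b ∈ branches U, ∀ i < M, b i = a i := by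
    intro b hb
    rw [hU] at hb
    have := branches_restr hb
    rw [seg_length] at this
    exact (seg_eq_iff _ _ _).1 this
  have hUF : ∀ b ∈ branches U, ∀ c ∈ branches U, F b ≠ iota c := by
    intro b hb c hc h
    have h1 : F b n = F a n :=
      hN b ((seg_eq_iff _ _ _).2 fun i hi => hUs b hb i (by omega))
    have h2 : iota c n = iota a n := by simp [iota, hUs c hc n hnM]
    exact hn (by rw [← h1, h, h2])
  have final : ∀ S0, IsPerfect S0 → S0 ⊆ U →
      (∀ k, ∃ R, IsPerfect R ∧ R ⊆ T k ∧
        ∀ b ∈ branches S0, ∀ c ∈ branches R, F b ≠ iota c) →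
      ∃ S : ℕ → Set (List Bool), (∀ n, IsPerfect (S n) ∧ S n ⊆ T n) ∧
      ((∀ a ∈ branches (S 0), F a ∉ ⋃ n, iota '' branches (S n)) ∨
       (∀ a ∈ branches (S 0), F a = iota a)) := by
    intro S0 hS0 hSU hk
    choose R hR1 hR2 hR3 using hk
    refine ⟨fun k => if k = 0 then S0 else R k, fun k => ?_, Or.inl ?_⟩
    · by_cases h : k = 0
      · subst h; simpa using ⟨hS0, hSU.trans hUT⟩
      · simpa [h] using ⟨hR1 k, hR2 k⟩
    · intro b hb hmem
      simp only [if_true] at hb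
      obtain ⟨k, c, hc, hcb⟩ := Set.mem_iUnion.1 hmem
      by_cases h : k = 0
      · simp only [h, if_true] at hc
        exact hUF b (branches_mono hSU hb) c (branches_mono hSU hc) hcb.symm
      · simp only [h, if_false] at hc
        exact hR3 k b hb c hc hcb.symm
  by_cases hA : ∃ c, ¬ (branches U ∩ F ⁻¹' {c}).Countable
  · obtain ⟨c, hc⟩ := hA
    obtain ⟨S0, h1, h2, h3⟩ := perfect_subtree (T := U)
      ((isClosed_branches U).inter (isClosed_singleton.preimage hF)).measurableSet hc
      Set.inter_subset_left
    refine final S0 h1 h2 fun k => ?_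
    obtain ⟨R, r1, r2, r3⟩ := perfect_subtree (T := T k) (C := branches (T k) \ iota ⁻¹' {c})
      ((isClosed_branches _).measurableSet.diff
        (isClosed_singleton.preimage iota_continuous).measurableSet)
      (fun h => branches_uncountable (hT k) (by
        have hs : (iota ⁻¹' {c}).Countable :=
          (Set.countable_singleton c).preimage_of_injOn iota_injective.injOn
        exact (h.union hs).mono (fun x hx => by
          by_cases hxc : x ∈ iota ⁻¹' {c}
          · exact Or.inr hxc
          · exact Or.inl ⟨hx, hxc⟩)))
      Set.sdiff_subset
    refine ⟨R, r1, r2, fun b hb d hd h => (r3 hd).2 ?_⟩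
    have : F b = c := (h3 hb).2
    exact h.symm.trans this
  · push Not at hA
    choose x hx using fun k => branches_nonempty (hT k)
    have hcount : (⋃ k, branches U ∩ F ⁻¹' {iota (x k)}).Countable :=
      Set.countable_iUnion fun k => hA _
    obtain ⟨S0, h1, h2, h3⟩ := perfect_subtree (T := U)
      (C := branches U \ ⋃ k, branches U ∩ F ⁻¹' {iota (x k)})
      ((isClosed_branches _).measurableSet.diff hcount.measurableSet)
      (fun h => branches_uncountable hUp ((h.union hcount).mono (fun y hy => by
          by_cases hyc : y ∈ ⋃ k, branches U ∩ F ⁻¹' {iota (x k)}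
          · exact Or.inr hyc
          · exact Or.inl ⟨hy, hyc⟩)))
      Set.sdiff_subset
    refine final S0 h1 h2 fun k => ?_
    have hcl : IsClosed (F '' branches S0) :=
      ((isClosed_branches S0).isCompact.image hF).isClosed
    have hxk : x k ∈ iota ⁻¹' (F '' branches S0)ᶜ := by
      rintro ⟨b, hb, hbx⟩
      exact (h3 hb).2 (Set.mem_iUnion.2 ⟨k, (h3 hb).1, hbx⟩)
    obtain ⟨m, hm⟩ := open_cyl (hcl.isOpen_compl.preimage iota_continuous) hxk
    refine ⟨restr (T k) (seg (x k) m), restr_perfect (hT k) (hx k m), restr_subset _ _, ?_⟩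
    intro b hb c hc h
    have := branches_restr hc
    rw [seg_length] at this
    exact hm c this ⟨b, hb, h⟩
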